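/- For n = 2 and A = 2[[a,b],[b,c]] positive definite with b ≠ 0, the sets E_α = [−α,α]×(0,∞) satisfy: P_{γ_A}(E_α) − P_{γ_A}(E_α^s) = 2·(√(det A)/√(2π))·(1 − √(1 + 4b²/c²))·α + o(α) as α → 0⁺; in particular, for all sufficiently small α > 0, P_{γ_A}(E_α) < P_{γ_A}(E_α^s), so Ehrhard symmetrization can strictly increase the anisotropic Gaussian perimeter. -/

import Mathlib

open MeasureTheory Metric Filter Set Asymptotics
open scoped ENNReal Topology

noncomputable section

/-- The anisotropic Gaussian weight `exp(−⟨A(x,y),(x,y)⟩/2) = exp(−ax²−2bxy−cy²)` for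
`A = 2[[a,b],[b,c]]`. -/
def w (a b c x y : ℝ) : ℝ := Real.exp (-(a * x ^ 2 + 2 * b * x * y + c * y ^ 2))

/-- The point of `ℝ²` with coordinates `(x, y)`. -/
def pt (x y : ℝ) : EuclideanSpace ℝ (Fin 2) :=
  (EuclideanSpace.equiv (Fin 2) ℝ).symm ![x, y]

/-- The set `E_α = [−α,α] × (0,∞) ⊆ ℝ²`. -/
def Eset (α : ℝ) : Set (EuclideanSpace ℝ (Fin 2)) :=
  {p | p 0 ∈ Set.Icc (-α) α ∧ 0 < p 1}

/-- The Ehrhard symmetrization of `E ⊆ ℝ²` in the direction `−e₂`: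
`E^s = {(x,y) : y < h(x)}` where `h(x) = φ_x⁻¹(v_E(x))`, expressed equivalently via
`φ_x(y) < v_E(x)` since `y ↦ φ_x(y) = ∫_{−∞}^y w(x,t) dt` is a strictly increasing
positive bijection onto `(0, μ_x(ℝ))`. -/
def ehr2 (a b c : ℝ) (E : Set (EuclideanSpace ℝ (Fin 2))) :
    Set (EuclideanSpace ℝ (Fin 2)) :=
  {p | (∫ y in Set.Iio (p 1), w a b c (p 0) y) <
        ∫ y in {y : ℝ | pt (p 0) y ∈ E}, w a b c (p 0) y}

/-- The essential boundary `∂^M E` (points of density neither `0` nor `1`). -/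
def essBoundary2 (E : Set (EuclideanSpace ℝ (Fin 2))) : Set (EuclideanSpace ℝ (Fin 2)) :=
  {x | ¬ Tendsto (fun r : ℝ => volume (E ∩ ball x r) / volume (ball x r)) (𝓝[>] 0) (𝓝 0) ∧
       ¬ Tendsto (fun r : ℝ => volume (E ∩ ball x r) / volume (ball x r)) (𝓝[>] 0) (𝓝 1)}

/-- The anisotropic Gaussian perimeter for `A = 2[[a,b],[b,c]]` (so
`√(det A) = √(4(ac−b²))` and the normalization is `√(det A)/√(2π)`):
`P_{γ_A}(E) = (√(det A)/√(2π)) ∫_{∂^M E} w dH¹`. -/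
def P2 (a b c : ℝ) (E : Set (EuclideanSpace ℝ (Fin 2))) : ℝ :=
  (Real.sqrt (4 * (a * c - b ^ 2)) / Real.sqrt (2 * Real.pi)) *
    ∫ x in essBoundary2 E, w a b c (x 0) (x 1) ∂(μH[(1 : ℝ)])

lemma pt_apply_zero (x y : ℝ) : pt x y 0 = x := by simp [pt]

lemma pt_apply_one (x y : ℝ) : pt x y 1 = y := by simp [pt]

lemma continuous_pt : Continuous fun q : ℝ × ℝ => pt q.1 q.2 := by
  unfold pt
  refine (ContinuousLinearEquiv.continuous _).comp ?_
  refine continuous_pi fun i => ?_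
  fin_cases i
  · simpa using continuous_fst
  · simpa using continuous_snd

lemma dist_pt (x y x' y' : ℝ) :
    dist (pt x y) (pt x' y') = Real.sqrt ((x - x') ^ 2 + (y - y') ^ 2) := by
  rw [EuclideanSpace.dist_eq]
  simp [Fin.sum_univ_two, pt, Real.dist_eq, sq_abs]

lemma volume_ball_mul (x y : EuclideanSpace ℝ (Fin 2)) {k r : ℝ} (hk : 0 ≤ k) :
    volume (ball y (k * r)) = ENNReal.ofReal (k ^ 2) * volume (ball x r) := by
  have h := Measure.addHaar_ball_mul (volume : Measure (EuclideanSpace ℝ (Fin 2))) y hk r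
  simpa [Measure.addHaar_ball_center] using h

/-- If, at every small scale `r`, both `E` and its complement contain a ball of radius `k * r`
inside `ball x r`, then `x` belongs to the essential boundary of `E`. -/
lemma mem_essBoundary2_of_balls {E : Set (EuclideanSpace ℝ (Fin 2))}
    {x : EuclideanSpace ℝ (Fin 2)} {k : ℝ} (hk : 0 < k)
    (hin : ∀ᶠ r in 𝓝[>] (0 : ℝ), ∃ y, ball y (k * r) ⊆ E ∩ ball x r)
    (hout : ∀ᶠ r in 𝓝[>] (0 : ℝ), ∃ y, ball y (k * r) ⊆ Eᶜ ∩ ball x r) :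
    x ∈ essBoundary2 E := by
  have hκ : 0 < ENNReal.ofReal (k ^ 2) := by
    rw [ENNReal.ofReal_pos]; positivity
  constructor
  · intro h
    refine absurd (ge_of_tendsto (b := ENNReal.ofReal (k ^ 2)) h ?_) (not_le.2 hκ)
    filter_upwards [hin, self_mem_nhdsWithin] with r ⟨y, hy⟩ hr
    rw [ENNReal.le_div_iff_mul_le (.inl (measure_ball_pos _ _ hr).ne')
      (.inl measure_ball_lt_top.ne), ← volume_ball_mul x y hk.le]
    exact measure_mono hy
  · intro h
    have h' := h.add_const (ENNReal.ofReal (k ^ 2))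
    have hle : (1 : ℝ≥0∞) + ENNReal.ofReal (k ^ 2) ≤ 1 := by
      refine le_of_tendsto h' ?_
      filter_upwards [hout, self_mem_nhdsWithin] with r ⟨y, hy⟩ hr
      have hb0 : volume (ball x r) ≠ 0 := (measure_ball_pos _ _ hr).ne'
      have hbt : volume (ball x r) ≠ ∞ := measure_ball_lt_top.ne
      have hdisj : Disjoint (E ∩ ball x r) (ball y (k * r)) :=
        Set.disjoint_left.2 fun z hz hz' => (hy hz').1 hz.1
      have hsum : volume (E ∩ ball x r) + ENNReal.ofReal (k ^ 2) * volume (ball x r)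
          ≤ volume (ball x r) := by
        rw [← volume_ball_mul x y hk.le, ← measure_union hdisj measurableSet_ball]
        exact measure_mono (Set.union_subset Set.inter_subset_right
          (hy.trans Set.inter_subset_right))
      calc volume (E ∩ ball x r) / volume (ball x r) + ENNReal.ofReal (k ^ 2)
          = (volume (E ∩ ball x r) + ENNReal.ofReal (k ^ 2) * volume (ball x r))
              / volume (ball x r) := by
            rw [ENNReal.add_div, ENNReal.mul_div_cancel_right hb0 hbt]
        _ ≤ 1 := ENNReal.div_le_of_le_mul (by simpa using hsum)
    exact absurd (ENNReal.lt_add_right ENNReal.one_ne_top hκ.ne') (not_lt.2 hle)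

lemma essBoundary2_subset_frontier (E : Set (EuclideanSpace ℝ (Fin 2))) :
    essBoundary2 E ⊆ frontier E := by
  rintro x ⟨h0, h1⟩
  rw [frontier_eq_closure_inter_closure, Set.mem_inter_iff]
  constructor
  · by_contra hx
    refine h0 (tendsto_const_nhds.congr' ?_)
    obtain ⟨ε, hε, hb⟩ := Metric.isOpen_iff.1 isClosed_closure.isOpen_compl x hx
    filter_upwards [Ioo_mem_nhdsGT hε] with r hr
    have : E ∩ ball x r = ∅ := by
      ext z
      simp only [Set.mem_inter_iff, Set.mem_empty_iff_false, iff_false, not_and]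
      exact fun hz hz' => hb (ball_subset_ball hr.2.le hz') (subset_closure hz)
    simp [this]
  · by_contra hx
    refine h1 (tendsto_const_nhds.congr' ?_)
    obtain ⟨ε, hε, hb⟩ := Metric.isOpen_iff.1 isClosed_closure.isOpen_compl x hx
    filter_upwards [Ioo_mem_nhdsGT hε] with r hr
    have : E ∩ ball x r = ball x r := by
      refine Set.inter_eq_right.2 fun z hz => ?_
      by_contra hzE
      exact hb (ball_subset_ball hr.2.le hz) (subset_closure hzE)
    rw [this, ENNReal.div_self (measure_ball_pos _ _ hr.1).ne' measure_ball_lt_top.ne]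

/-- The essential boundary of a convex set with nonempty interior is its frontier. -/
lemma Convex.essBoundary2_eq_frontier {E : Set (EuclideanSpace ℝ (Fin 2))} (hE : Convex ℝ E)
    (hne : (interior E).Nonempty) : essBoundary2 E = frontier E := by
  refine (essBoundary2_subset_frontier E).antisymm fun x hx => ?_
  obtain ⟨y, hy⟩ := hne
  obtain ⟨ρ, hρ, hball⟩ := Metric.isOpen_iff.1 isOpen_interior y hy
  set D := ‖y - x‖ + ρ with hD
  have hDpos : 0 < D := by positivity
  refine mem_essBoundary2_of_balls (k := ρ / D) (by positivity) ?_ ?_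
  · filter_upwards [Ioo_mem_nhdsGT hDpos] with r hr
    set t := r / D with ht
    have htpos : 0 < t := div_pos hr.1 hDpos
    have ht1 : t < 1 := (div_lt_one hDpos).2 hr.2
    have htr : t * D = r := by rw [ht]; field_simp
    have hrad : ρ / D * r = t * ρ := by rw [ht]; ring
    refine ⟨x + t • (y - x), fun z hz => ?_⟩
    rw [hrad, mem_ball_iff_norm] at hz
    constructor
    · set u := y + t⁻¹ • (z - (x + t • (y - x))) with hu
      have huE : u ∈ interior E := by
        apply hball
        rw [mem_ball_iff_norm, hu, add_sub_cancel_left, norm_smul, norm_inv, Real.norm_eq_abs,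
          abs_of_pos htpos, inv_mul_lt_iff₀ htpos]
        exact hz
      have hz_eq : z = t • u + (1 - t) • x := by
        rw [hu, smul_add, smul_inv_smul₀ htpos.ne']
        module
      rw [hz_eq]
      exact interior_subset (hE.combo_interior_closure_mem_interior huE hx.1 htpos
        (by linarith) (by ring))
    · rw [mem_ball_iff_norm]
      calc ‖z - x‖ = ‖(z - (x + t • (y - x))) + t • (y - x)‖ := by congr 1; module
        _ ≤ ‖z - (x + t • (y - x))‖ + ‖t • (y - x)‖ := norm_add_le _ _
        _ < t * ρ + t * ‖y - x‖ := by
          rw [norm_smul, Real.norm_eq_abs, abs_of_pos htpos]; linarith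
        _ = r := by rw [← htr, hD]; ring
  · filter_upwards [self_mem_nhdsWithin] with r hr
    set t := r / D with ht
    have htpos : 0 < t := div_pos hr hDpos
    have htr : t * D = r := by rw [ht]; field_simp
    have hrad : ρ / D * r = t * ρ := by rw [ht]; ring
    refine ⟨x - t • (y - x), fun z hz => ?_⟩
    rw [hrad, mem_ball_iff_norm] at hz
    constructor
    · intro hzE
      set u := y - t⁻¹ • (z - (x - t • (y - x))) with hu
      have huE : u ∈ interior E := by
        apply hball
        rw [mem_ball_iff_norm, hu, sub_sub_cancel_left, norm_neg, norm_smul, norm_inv,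
          Real.norm_eq_abs, abs_of_pos htpos, inv_mul_lt_iff₀ htpos]
        exact hz
      have hx_eq : (t / (1 + t)) • u + (1 / (1 + t)) • z = x := by
        have h1 : t • u + z = (1 + t) • x := by
          rw [hu, smul_sub, smul_inv_smul₀ htpos.ne']
          module
        have h2 : (1 + t) ≠ 0 := by positivity
        rw [← inv_smul_smul₀ h2 x, ← h1, smul_add, smul_smul]
        congr 2 <;> ring
      refine hx.2 (hx_eq ▸ hE.combo_interior_self_mem_interior huE hzE (by positivity)
        (by positivity) (by field_simp; ring))
    · rw [mem_ball_iff_norm]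
      calc ‖z - x‖ = ‖(z - (x - t • (y - x))) - t • (y - x)‖ := by congr 1; module
        _ ≤ ‖z - (x - t • (y - x))‖ + ‖t • (y - x)‖ := norm_sub_le _ _
        _ < t * ρ + t * ‖y - x‖ := by
          rw [norm_smul, Real.norm_eq_abs, abs_of_pos htpos]; linarith
        _ = r := by rw [← htr, hD]; ring

/-- The part of the strip `[-α, α] × ℝ` above (`s = 1`) or below (`s = -1`) the line of slope
`m` through the origin. -/
def halfStrip (m s α : ℝ) : Set (EuclideanSpace ℝ (Fin 2)) :=
  {p | p 0 ∈ Set.Icc (-α) α ∧ 0 < s * (p 1 - m * p 0)}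

/-- The shear homeomorphism `(x, y) ↦ (x, s (y - m x))`, where `s = ±1`. -/
def shearHomeomorph (m s : ℝ) (hs : s * s = 1) : EuclideanSpace ℝ (Fin 2) ≃ₜ ℝ × ℝ where
  toFun p := (p 0, s * (p 1 - m * p 0))
  invFun q := pt q.1 (m * q.1 + s * q.2)
  left_inv p := by
    ext i
    fin_cases i
    · exact pt_apply_zero _ _
    · refine (pt_apply_one _ _).trans ?_
      show m * p 0 + s * (s * (p 1 - m * p 0)) = p 1
      linear_combination (p 1 - m * p 0) * hs
  right_inv q := by
    refine Prod.ext (pt_apply_zero q.1 (m * q.1 + s * q.2)) ?_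
    show s * (pt q.1 (m * q.1 + s * q.2) 1 - m * pt q.1 (m * q.1 + s * q.2) 0) = q.2
    rw [pt_apply_zero, pt_apply_one]
    linear_combination q.2 * hs
  continuous_toFun := by fun_prop
  continuous_invFun := continuous_pt.comp (f := fun q : ℝ × ℝ => (q.1, m * q.1 + s * q.2))
    (by fun_prop)

lemma halfStrip_eq_preimage (m s α : ℝ) (hs : s * s = 1) :
    halfStrip m s α = shearHomeomorph m s hs ⁻¹' (Set.Icc (-α) α ×ˢ Set.Ioi 0) := rfl

lemma frontier_halfStrip {m s α : ℝ} (hs : s * s = 1) (hα : 0 < α) :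
    frontier (halfStrip m s α) =
      {p | p 0 ∈ Set.Icc (-α) α ∧ p 1 = m * p 0} ∪
        ({p | p 0 = α ∧ 0 ≤ s * (p 1 - m * p 0)} ∪
          {p | p 0 = -α ∧ 0 ≤ s * (p 1 - m * p 0)}) := by
  have hs0 : s ≠ 0 := by rintro rfl; simp at hs
  rw [halfStrip_eq_preimage m s α hs, ← Homeomorph.preimage_frontier, frontier_prod_eq,
    frontier_Ioi, frontier_Icc (by linarith), closure_Icc, closure_Ioi]
  ext p
  have h1 : s * (p 1 - m * p 0) = 0 ↔ p 1 = m * p 0 := by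
    rw [mul_eq_zero, or_iff_right hs0, sub_eq_zero]
  have hL : shearHomeomorph m s hs p = (p 0, s * (p 1 - m * p 0)) := rfl
  simp only [Set.mem_preimage, hL, Set.mem_union,
    Set.mem_prod, Set.mem_singleton_iff, Set.mem_insert_iff, Set.mem_Ici, Set.mem_ofPred_eq, h1]
  tauto

lemma convex_halfStrip (m s α : ℝ) : Convex ℝ (halfStrip m s α) := by
  intro p hp q hq u v hu hv huv
  obtain ⟨hp0, hp1⟩ := hp
  obtain ⟨hq0, hq1⟩ := hq
  refine ⟨?_, ?_⟩
  · simpa using convex_Icc (-α) α hp0 hq0 hu hv huv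
  · have := convex_Ioi (0 : ℝ) hp1 hq1 hu hv huv
    simp only [smul_eq_mul, Set.mem_Ioi] at this
    simp only [PiLp.add_apply, PiLp.smul_apply, smul_eq_mul]
    linarith

lemma interior_halfStrip_nonempty {m s α : ℝ} (hs : s * s = 1) (hα : 0 < α) :
    (interior (halfStrip m s α)).Nonempty := by
  rw [halfStrip_eq_preimage m s α hs, ← Homeomorph.preimage_interior, interior_prod_eq,
    interior_Icc, interior_Ioi]
  refine Set.Nonempty.preimage ⟨(0, 1), ?_⟩ (Homeomorph.surjective _)
  simp [hα]

lemma Isometry.restrict_hausdorffMeasure_image {γ : ℝ → EuclideanSpace ℝ (Fin 2)}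
    (hγ : Isometry γ) (S : Set ℝ) :
    (μH[(1 : ℝ)] : Measure (EuclideanSpace ℝ (Fin 2))).restrict (γ '' S) =
      (Measure.map γ volume).restrict (γ '' S) := by
  rw [← hausdorffMeasure_real, hγ.map_hausdorffMeasure (.inl zero_le_one),
    Measure.restrict_restrict_of_subset (Set.image_subset_range _ _)]

lemma Isometry.setIntegral_image_hausdorffMeasure {γ : ℝ → EuclideanSpace ℝ (Fin 2)}
    (hγ : Isometry γ) (S : Set ℝ) (f : EuclideanSpace ℝ (Fin 2) → ℝ) :
    ∫ x in γ '' S, f x ∂(μH[(1 : ℝ)]) = ∫ t in S, f (γ t) := by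
  rw [hγ.restrict_hausdorffMeasure_image,
    hγ.isClosedEmbedding.measurableEmbedding.setIntegral_map, hγ.injective.preimage_image]

lemma Isometry.integrableOn_image_hausdorffMeasure {γ : ℝ → EuclideanSpace ℝ (Fin 2)}
    (hγ : Isometry γ) {S : Set ℝ} {f : EuclideanSpace ℝ (Fin 2) → ℝ}
    (hf : IntegrableOn (fun t => f (γ t)) S) : IntegrableOn f (γ '' S) (μH[(1 : ℝ)]) := by
  rw [IntegrableOn, hγ.restrict_hausdorffMeasure_image, ← IntegrableOn,
    hγ.isClosedEmbedding.measurableEmbedding.integrableOn_map_iff, hγ.injective.preimage_image]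
  exact hf

lemma isometry_slantedLine (m : ℝ) :
    Isometry fun t : ℝ => pt (t / Real.sqrt (1 + m ^ 2)) (m * (t / Real.sqrt (1 + m ^ 2))) := by
  refine Isometry.of_dist_eq fun t t' => ?_
  have hpos : 0 < 1 + m ^ 2 := by positivity
  have hsq := Real.sq_sqrt hpos.le
  rw [dist_pt, Real.dist_eq, ← Real.sqrt_sq_eq_abs]
  congr 1
  have : Real.sqrt (1 + m ^ 2) ≠ 0 := (Real.sqrt_pos.2 hpos).ne'
  field_simp
  rw [hsq]

lemma isometry_verticalLine (x y : ℝ) {s : ℝ} (hs : s * s = 1) :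
    Isometry fun t : ℝ => pt x (y + s * t) := by
  refine Isometry.of_dist_eq fun t t' => ?_
  rw [dist_pt, Real.dist_eq, ← Real.sqrt_sq_eq_abs]
  congr 1
  linear_combination (t - t') ^ 2 * hs

lemma image_slantedLine (m α : ℝ) :
    (fun t : ℝ => pt (t / Real.sqrt (1 + m ^ 2)) (m * (t / Real.sqrt (1 + m ^ 2)))) ''
        Set.Icc (-(α * Real.sqrt (1 + m ^ 2))) (α * Real.sqrt (1 + m ^ 2)) =
      {p | p 0 ∈ Set.Icc (-α) α ∧ p 1 = m * p 0} := by
  have hk : 0 < Real.sqrt (1 + m ^ 2) := Real.sqrt_pos.2 (by positivity)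
  ext p
  constructor
  · rintro ⟨t, ⟨h1, h2⟩, rfl⟩
    refine ⟨?_, ?_⟩
    · rw [pt_apply_zero, Set.mem_Icc, le_div_iff₀ hk, div_le_iff₀ hk]
      exact ⟨by linarith, h2⟩
    · rw [pt_apply_zero, pt_apply_one]
  · rintro ⟨⟨h1, h2⟩, h3⟩
    refine ⟨p 0 * Real.sqrt (1 + m ^ 2), ⟨by nlinarith, by nlinarith⟩, ?_⟩
    have hx : p 0 * Real.sqrt (1 + m ^ 2) / Real.sqrt (1 + m ^ 2) = p 0 := by field_simp
    ext i
    fin_cases i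
    · simp [pt, hx]
    · simp [pt, hx, h3]

lemma image_verticalLine (m x : ℝ) {s : ℝ} (hs : s * s = 1) :
    (fun t : ℝ => pt x (m * x + s * t)) '' Set.Ici 0 =
      {p | p 0 = x ∧ 0 ≤ s * (p 1 - m * p 0)} := by
  ext p
  constructor
  · rintro ⟨t, ht, rfl⟩
    refine ⟨pt_apply_zero _ _, ?_⟩
    rw [pt_apply_zero, pt_apply_one]
    have : s * (m * x + s * t - m * x) = t := by linear_combination t * hs
    rw [this]; exact ht
  · rintro ⟨rfl, h⟩
    refine ⟨_, h, ?_⟩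
    ext i
    fin_cases i
    · simp [pt]
    · simp only [pt, Fin.mk_one, EuclideanSpace.equiv, PiLp.coe_symm_continuousLinearEquiv]
      show m * p 0 + s * (s * (p 1 - m * p 0)) = p 1
      linear_combination (p 1 - m * p 0) * hs

lemma continuous_w (a b c : ℝ) : Continuous fun q : ℝ × ℝ => w a b c q.1 q.2 := by
  unfold w; fun_prop

lemma integrable_w (a b x : ℝ) {c : ℝ} (hc : 0 < c) : Integrable fun y => w a b c x y := by
  have h := ((integrable_exp_neg_mul_sq hc).comp_add_right (b * x / c)).const_mul
    (Real.exp (-(a - b ^ 2 / c) * x ^ 2))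
  refine h.congr (.of_forall fun y => ?_)
  simp only [w, ← Real.exp_add]
  congr 1
  field_simp
  ring

/-- Computation of the weighted length of the essential boundary of a half-strip. -/
lemma integral_essBoundary2_halfStrip (a b : ℝ) {c m s α : ℝ} (hc : 0 < c) (hs : s * s = 1)
    (hα : 0 < α) :
    ∫ p in essBoundary2 (halfStrip m s α), w a b c (p 0) (p 1) ∂(μH[(1 : ℝ)]) =
      Real.sqrt (1 + m ^ 2) * (∫ x in -α..α, w a b c x (m * x)) +
        ((∫ t in Set.Ici (0 : ℝ), w a b c α (m * α + s * t)) +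
          ∫ t in Set.Ici (0 : ℝ), w a b c (-α) (m * -α + s * t)) := by
  have hs0 : s ≠ 0 := by rintro rfl; simp at hs
  have hk : 0 < Real.sqrt (1 + m ^ 2) := Real.sqrt_pos.2 (by positivity)
  have hcont : Continuous fun p : EuclideanSpace ℝ (Fin 2) => w a b c (p 0) (p 1) :=
    (continuous_w a b c).comp (f := fun p : EuclideanSpace ℝ (Fin 2) => (p 0, p 1))
      (by fun_prop)
  have hside (x : ℝ) : IntegrableOn (fun p : EuclideanSpace ℝ (Fin 2) => w a b c (p 0) (p 1))
      ((fun t : ℝ => pt x (m * x + s * t)) '' Set.Ici 0) (μH[(1 : ℝ)]) := by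
    refine (isometry_verticalLine x _ hs).integrableOn_image_hausdorffMeasure ?_
    simp only [pt_apply_zero, pt_apply_one]
    exact (((integrable_w a b x hc).comp_add_left (m * x)).comp_mul_left' hs0).integrableOn
  have hmeas (x : ℝ) : MeasurableSet ((fun t : ℝ => pt x (m * x + s * t)) '' Set.Ici 0) :=
    ((isometry_verticalLine x _ hs).isClosedEmbedding.isClosedMap _ isClosed_Ici).measurableSet
  have htop : IntegrableOn (fun p : EuclideanSpace ℝ (Fin 2) => w a b c (p 0) (p 1))
      ((fun t : ℝ => pt (t / Real.sqrt (1 + m ^ 2)) (m * (t / Real.sqrt (1 + m ^ 2)))) ''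
        Set.Icc (-(α * Real.sqrt (1 + m ^ 2))) (α * Real.sqrt (1 + m ^ 2))) (μH[(1 : ℝ)]) :=
    (isometry_slantedLine m).integrableOn_image_hausdorffMeasure
      (hcont.comp (isometry_slantedLine m).continuous).integrableOn_Icc
  have := Measure.nullSingletonClass_hausdorff (EuclideanSpace ℝ (Fin 2)) zero_lt_one
  have hd : AEDisjoint μH[(1 : ℝ)] {p : EuclideanSpace ℝ (Fin 2) | p 0 ∈ Set.Icc (-α) α ∧
        p 1 = m * p 0} ({p | p 0 = α ∧ 0 ≤ s * (p 1 - m * p 0)} ∪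
          {p | p 0 = -α ∧ 0 ≤ s * (p 1 - m * p 0)}) := by
    have hsub : {p : EuclideanSpace ℝ (Fin 2) | p 0 ∈ Set.Icc (-α) α ∧
        p 1 = m * p 0} ∩ ({p | p 0 = α ∧ 0 ≤ s * (p 1 - m * p 0)} ∪
          {p | p 0 = -α ∧ 0 ≤ s * (p 1 - m * p 0)}) ⊆ {pt α (m * α), pt (-α) (m * -α)} := by
      rintro p ⟨⟨-, h1⟩, h2⟩
      refine h2.imp (fun h => ?_) (fun h => ?_) <;>
      · ext i
        fin_cases i
        · exact h.1.trans (pt_apply_zero _ _).symm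
        · exact (h1.trans (by rw [h.1])).trans (pt_apply_one _ _).symm
    exact measure_mono_null hsub ((Set.toFinite _).measure_zero _)
  have hd' : Disjoint {p : EuclideanSpace ℝ (Fin 2) | p 0 = α ∧ 0 ≤ s * (p 1 - m * p 0)}
      {p | p 0 = -α ∧ 0 ≤ s * (p 1 - m * p 0)} :=
    Set.disjoint_left.2 fun p h h' => by
      have h1 := h.1
      have h2 := h'.1
      linarith
  rw [(convex_halfStrip m s α).essBoundary2_eq_frontier (interior_halfStrip_nonempty hs hα),
    frontier_halfStrip hs hα]
  simp only [← image_slantedLine, ← image_verticalLine _ _ hs] at hd hd' ⊢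
  rw [setIntegral_union₀ hd ((hmeas _).union (hmeas _)).nullMeasurableSet htop
    ((hside _).union (hside _)), setIntegral_union hd' (hmeas _) (hside _) (hside _),
    (isometry_verticalLine α _ hs).setIntegral_image_hausdorffMeasure,
    (isometry_verticalLine (-α) _ hs).setIntegral_image_hausdorffMeasure,
    (isometry_slantedLine m).setIntegral_image_hausdorffMeasure]
  simp only [pt_apply_zero, pt_apply_one]
  congr 1
  have hle : -(α * Real.sqrt (1 + m ^ 2)) ≤ α * Real.sqrt (1 + m ^ 2) := by
    have : 0 < α * Real.sqrt (1 + m ^ 2) := by positivity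
    linarith
  rw [integral_Icc_eq_integral_Ioc, ← intervalIntegral.integral_of_le hle,
    intervalIntegral.integral_comp_div (fun x => w a b c x (m * x)) hk.ne', smul_eq_mul,
    neg_div, mul_div_cancel_right₀ _ hk.ne']

lemma Eset_eq_halfStrip (α : ℝ) : Eset α = halfStrip 0 1 α := by
  ext p; simp [Eset, halfStrip]

/-- The weight on a vertical line is symmetric about the point `-b x / c`. -/
lemma w_reflect (a b x y : ℝ) {c : ℝ} (hc : 0 < c) :
    w a b c x (-2 * b / c * x - y) = w a b c x y := by
  unfold w
  congr 1
  field_simp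
  ring

lemma integral_Iio_w (a b x y : ℝ) {c : ℝ} (hc : 0 < c) :
    ∫ t in Set.Iio y, w a b c x t = ∫ t in Set.Ioi (-2 * b / c * x - y), w a b c x t := by
  rw [← (Measure.measurePreserving_sub_left volume (-2 * b / c * x)).setIntegral_preimage_emb
    (Homeomorph.subLeft _).measurableEmbedding, Set.preimage_const_sub_Iio]
  simp only [w_reflect a b _ _ hc]

lemma strictAnti_integral_Ioi_w (a b x : ℝ) {c : ℝ} (hc : 0 < c) :
    StrictAnti fun y => ∫ t in Set.Ioi y, w a b c x t := by
  intro y z hyz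
  have h := intervalIntegral.integral_Ioi_sub_Ioi (integrable_w a b x hc).integrableOn hyz.le
  have hpos : 0 < ∫ t in y..z, w a b c x t :=
    intervalIntegral.intervalIntegral_pos_of_pos (integrable_w a b x hc).intervalIntegrable
      (fun t => Real.exp_pos _) hyz
  simp only at h ⊢
  linarith

lemma ehr2_Eset (a b α : ℝ) {c : ℝ} (hc : 0 < c) :
    ehr2 a b c (Eset α) = halfStrip (-2 * b / c) (-1) α := by
  ext p
  have hslice : {y : ℝ | pt (p 0) y ∈ Eset α} = {y | p 0 ∈ Set.Icc (-α) α ∧ 0 < y} := by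
    ext y
    simp only [Eset, Set.mem_ofPred_eq, pt_apply_zero, pt_apply_one]
  by_cases hp : p 0 ∈ Set.Icc (-α) α
  · have hs' : {y : ℝ | pt (p 0) y ∈ Eset α} = Set.Ioi 0 := by
      rw [hslice]; ext y; simp only [hp, true_and]; rfl
    simp only [ehr2, halfStrip, Set.mem_ofPred_eq, hs', hp, true_and, integral_Iio_w a b _ _ hc]
    rw [(strictAnti_integral_Ioi_w a b (p 0) hc).lt_iff_gt]
    constructor <;> intro h <;> linarith
  · have hs' : {y : ℝ | pt (p 0) y ∈ Eset α} = ∅ := by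
      rw [hslice]; ext y; simp only [hp, false_and]; rfl
    simp only [ehr2, halfStrip, Set.mem_ofPred_eq, hs', hp, false_and, iff_false, not_lt,
      Measure.restrict_empty, integral_zero_measure]
    exact integral_nonneg fun t => (Real.exp_pos _).le

/-- The exact difference of the perimeters of `E_α` and its Ehrhard symmetrization. -/
lemma P2_Eset_sub_P2_ehr2 (a b : ℝ) {c α : ℝ} (hc : 0 < c) (hα : 0 < α) :
    P2 a b c (Eset α) - P2 a b c (ehr2 a b c (Eset α)) =
      (Real.sqrt (4 * (a * c - b ^ 2)) / Real.sqrt (2 * Real.pi)) *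
        (1 - Real.sqrt (1 + 4 * b ^ 2 / c ^ 2)) * ∫ x in -α..α, Real.exp (-(a * x ^ 2)) := by
  rw [ehr2_Eset a b α hc, Eset_eq_halfStrip, P2, P2,
    integral_essBoundary2_halfStrip a b hc (by norm_num) hα,
    integral_essBoundary2_halfStrip a b hc (by norm_num) hα]
  have h1 (x : ℝ) : w a b c x (0 * x) = Real.exp (-(a * x ^ 2)) := by
    unfold w; congr 1; ring
  have h2 (x : ℝ) : w a b c x (-2 * b / c * x) = Real.exp (-(a * x ^ 2)) := by
    rw [← h1, ← w_reflect a b _ _ hc]; congr 1; ring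
  have h3 (x t : ℝ) : w a b c x (-2 * b / c * x + -1 * t) = w a b c x (0 * x + 1 * t) := by
    rw [← w_reflect a b x (0 * x + 1 * t) hc]; congr 1; ring
  have h4 : (-2 * b / c) ^ 2 = 4 * b ^ 2 / c ^ 2 := by ring
  simp only [h1, h2, h3, h4]
  norm_num
  ring

lemma isLittleO_integral_symm (a : ℝ) :
    (fun α : ℝ => (∫ x in -α..α, Real.exp (-(a * x ^ 2))) - 2 * α) =o[𝓝 0] fun α => α := by
  have hcont : Continuous fun x : ℝ => Real.exp (-(a * x ^ 2)) := by fun_prop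
  have hF : HasDerivAt (fun u : ℝ => ∫ x in (0 : ℝ)..u, Real.exp (-(a * x ^ 2))) 1 0 := by
    simpa using intervalIntegral.integral_hasDerivAt_right (a := 0) (b := 0)
      (hcont.intervalIntegrable _ _) (hcont.stronglyMeasurableAtFilter _ _) hcont.continuousAt
  have hG : HasDerivAt (fun u : ℝ => ∫ x in (0 : ℝ)..-u, Real.exp (-(a * x ^ 2))) (-1) 0 := by
    have hF' : HasDerivAt (fun u : ℝ => ∫ x in (0 : ℝ)..u, Real.exp (-(a * x ^ 2))) 1 (-0) := by
      simpa using hF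
    simpa [Function.comp_def] using hF'.scomp 0 (hasDerivAt_neg 0)
  have h := hasDerivAt_iff_isLittleO.1 (hF.sub hG)
  refine (h.congr_left fun α => ?_).congr_right fun α => sub_zero α
  have := intervalIntegral.integral_interval_sub_left
    (hcont.intervalIntegrable (μ := volume) 0 α) (hcont.intervalIntegrable 0 (-α))
  simp only [Pi.sub_apply, neg_zero, smul_eq_mul, this, intervalIntegral.integral_same]
  ring

/-- For `n = 2` and `A = 2[[a,b],[b,c]]` positive definite with `b ≠ 0`,
the sets `E_α = [−α,α]×(0,∞)` satisfy
`P_{γ_A}(E_α) − P_{γ_A}(E_α^s) = 2(√(det A)/√(2π))(1 − √(1+4b²/c²))·α + o(α)` as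
`α → 0⁺`; in particular, for all sufficiently small `α > 0` one has
`P_{γ_A}(E_α) < P_{γ_A}(E_α^s)`: Ehrhard symmetrization can strictly increase the
anisotropic Gaussian perimeter. -/
theorem ehrhard_can_increase_perimeter (a b c : ℝ)
    (ha : 0 < a) (hc : 0 < c) (hb : b ≠ 0) (hpd : b ^ 2 < a * c) :
    (fun α : ℝ => P2 a b c (Eset α) - P2 a b c (ehr2 a b c (Eset α)) -
        2 * (Real.sqrt (4 * (a * c - b ^ 2)) / Real.sqrt (2 * Real.pi)) *
          (1 - Real.sqrt (1 + 4 * b ^ 2 / c ^ 2)) * α)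
      =o[𝓝[>] (0 : ℝ)] (fun α : ℝ => α) ∧
    ∃ δ : ℝ, 0 < δ ∧ ∀ α ∈ Set.Ioo (0 : ℝ) δ,
      P2 a b c (Eset α) < P2 a b c (ehr2 a b c (Eset α)) := by
  constructor
  · have h := ((isLittleO_integral_symm a).mono (nhdsWithin_le_nhds (s := Set.Ioi 0))).const_mul_left
      ((Real.sqrt (4 * (a * c - b ^ 2)) / Real.sqrt (2 * Real.pi)) *
        (1 - Real.sqrt (1 + 4 * b ^ 2 / c ^ 2)))
    refine h.congr' ?_ .rfl
    filter_upwards [self_mem_nhdsWithin] with α hα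
    rw [P2_Eset_sub_P2_ehr2 a b hc hα]
    ring
  · refine ⟨1, one_pos, fun α hα => sub_neg.1 ?_⟩
    rw [P2_Eset_sub_P2_ehr2 a b hc hα.1]
    have hC : 0 < Real.sqrt (4 * (a * c - b ^ 2)) / Real.sqrt (2 * Real.pi) :=
      div_pos (Real.sqrt_pos.2 (by linarith)) (Real.sqrt_pos.2 (by positivity))
    have hS : 1 < Real.sqrt (1 + 4 * b ^ 2 / c ^ 2) := by
      rw [Real.lt_sqrt zero_le_one]
      have : 0 < 4 * b ^ 2 / c ^ 2 := by positivity
      linarith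
    have hJ : 0 < ∫ x in -α..α, Real.exp (-(a * x ^ 2)) :=
      intervalIntegral.intervalIntegral_pos_of_pos
        ((by fun_prop : Continuous fun x : ℝ => Real.exp (-(a * x ^ 2))).intervalIntegrable _ _)
        (fun x => Real.exp_pos _) (by linarith [hα.1])
    exact mul_neg_of_neg_of_pos (mul_neg_of_pos_of_neg hC (by linarith)) hJ
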